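/- Let S ⊆ ℕ^d be a good semigroup, E ⊆ S a nonempty proper good ideal, A = S \ E with levels A₁,…,A_N (set A_{N+1} := ∅). Let α ∈ A_i with Δ^E_F(α) ≠ ∅ for some F ⊊ I, and let θ ∈ Δ̃^S_{F̂}(α) with θ and α consecutive in S. Then θ ∈ A_i provided at least one of the following holds: (1) there exists δ ∈ A_{i+1} with δ_j > θ_j for every j; (2) there exists δ ∈ A_{i+1} ∩ Δ^S_H(θ) for some H ⊆ F; (3) there exists δ ∈ A_i ∩ Δ^S_F(α); (4) there exist δ ∈ A_{i+1} ∩ Δ^S_F(α) and β ∈ Δ̃^E_F(α) with δ ≤ β; (5) there exists δ ∈ A_{i+1} ∩ Δ^S_F(α) with Δ̃^E_F(δ) = ∅. -/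

import Mathlib

/-! Common definitions for good semigroups in `ℕ^d`. -/

/-- A *good semigroup*: a submonoid of `ℕ^d` satisfying (G1), (G2), (G3). -/
def IsGoodSemigroup {d : ℕ} (S : Set (Fin d → ℕ)) : Prop :=
  (0 : Fin d → ℕ) ∈ S ∧
  (∀ α ∈ S, ∀ β ∈ S, α + β ∈ S) ∧
  (∀ α ∈ S, ∀ β ∈ S, α ⊓ β ∈ S) ∧
  (∀ α ∈ S, ∀ β ∈ S, α ≠ β → ∀ i : Fin d, α i = β i →
    ∃ ε ∈ S, α i < ε i ∧ ∀ j : Fin d, j ≠ i →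
      min (α j) (β j) ≤ ε j ∧ (α j ≠ β j → ε j = min (α j) (β j))) ∧
  (∃ c : Fin d → ℕ, ∀ x : Fin d → ℕ, c ≤ x → x ∈ S)

/-- A *good ideal* of `S`: a nonempty subset `E ⊆ S` with `E + S ⊆ E`
satisfying (G1) and (G2). -/
def IsGoodIdeal {d : ℕ} (S E : Set (Fin d → ℕ)) : Prop :=
  E ⊆ S ∧ E.Nonempty ∧
  (∀ α ∈ E, ∀ σ ∈ S, α + σ ∈ E) ∧
  (∀ α ∈ E, ∀ β ∈ E, α ⊓ β ∈ E) ∧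
  (∀ α ∈ E, ∀ β ∈ E, α ≠ β → ∀ i : Fin d, α i = β i →
    ∃ ε ∈ E, α i < ε i ∧ ∀ j : Fin d, j ≠ i →
      min (α j) (β j) ≤ ε j ∧ (α j ≠ β j → ε j = min (α j) (β j)))

/-- `Δ^E_F(α)`. -/
def DeltaSet {d : ℕ} (E : Set (Fin d → ℕ)) (F : Finset (Fin d)) (α : Fin d → ℕ) :
    Set (Fin d → ℕ) :=
  {β | β ∈ E ∧ (∀ i ∈ F, β i = α i) ∧ ∀ j ∉ F, α j < β j}

/-- `Δ̃^E_F(α)`. -/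
def DeltaTilde {d : ℕ} (E : Set (Fin d → ℕ)) (F : Finset (Fin d)) (α : Fin d → ℕ) :
    Set (Fin d → ℕ) :=
  {β | β ∈ E ∧ (∀ i ∈ F, β i = α i) ∧ ∀ j ∉ F, α j ≤ β j} \ {α}

/-- `c` is the conductor of `E`: the minimal element with `c + ℕ^d ⊆ E`. -/
def IsConductor {d : ℕ} (E : Set (Fin d → ℕ)) (c : Fin d → ℕ) : Prop :=
  (∀ x : Fin d → ℕ, c ≤ x → x ∈ E) ∧
  ∀ c' : Fin d → ℕ, (∀ x : Fin d → ℕ, c' ≤ x → x ∈ E) → c ≤ c'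

/-- `α ≤ β` are consecutive in `A`. -/
def ConsecutiveIn {d : ℕ} (A : Set (Fin d → ℕ)) (α β : Fin d → ℕ) : Prop :=
  α ∈ A ∧ β ∈ A ∧ α ≤ β ∧
  ∀ δ ∈ A, α ≤ δ → δ ≤ β → δ = α ∨ δ = β

/-- `α` is the complete infimum of the family `β` (with `Δ`-sets taken in `S`). -/
def IsCompleteInf {d : ℕ} (S : Set (Fin d → ℕ)) (α : Fin d → ℕ) {r : ℕ}
    (β : Fin r → Fin d → ℕ) : Prop :=
  2 ≤ r ∧ ∃ F : Fin r → Finset (Fin d),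
    (∀ j, (F j).Nonempty ∧ F j ≠ Finset.univ) ∧
    (∀ j, β j ∈ DeltaSet S (F j) α) ∧
    (∀ j k, j ≠ k → α = β j ⊓ β k) ∧
    (∀ x : Fin d, ∃ j, x ∉ F j)

/-- `α` is a complete infimum in `A` of the elements of the family `β`. -/
def IsCompleteInfIn {d : ℕ} (S A : Set (Fin d → ℕ)) (α : Fin d → ℕ) {r : ℕ}
    (β : Fin r → Fin d → ℕ) : Prop :=
  α ∈ A ∧ (∀ k, β k ∈ A) ∧ IsCompleteInf S α β

/-- The order `≤≤`: `α = β` or `α_j < β_j` for every `j`. -/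
def DomLE {d : ℕ} (α β : Fin d → ℕ) : Prop := α = β ∨ ∀ j, α j < β j

/-- The set `B`: maximal elements of `(S \ E) \ prev` with respect to `≤≤`. -/
def Bstep {d : ℕ} (S E prev : Set (Fin d → ℕ)) : Set (Fin d → ℕ) :=
  {α | α ∈ (S \ E) \ prev ∧ ∀ β ∈ (S \ E) \ prev, DomLE α β → β = α}

/-- The set `C`: elements of `B` that are complete infima in `S \ E` of
elements of `B` (with `1 < r ≤ d`). -/
def Cstep {d : ℕ} (S E prev : Set (Fin d → ℕ)) : Set (Fin d → ℕ) :=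
  {α | α ∈ Bstep S E prev ∧ ∃ r : ℕ, 1 < r ∧ r ≤ d ∧
    ∃ β : Fin r → Fin d → ℕ, (∀ k, β k ∈ Bstep S E prev) ∧
      IsCompleteInfIn S (S \ E) α β}

/-- `D = B \ C`. -/
def Dstep {d : ℕ} (S E prev : Set (Fin d → ℕ)) : Set (Fin d → ℕ) :=
  Bstep S E prev \ Cstep S E prev

/-- `Dacc S E i = D^(1) ∪ ⋯ ∪ D^(i)`. -/
def Dacc {d : ℕ} (S E : Set (Fin d → ℕ)) : ℕ → Set (Fin d → ℕ)
  | 0 => ∅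
  | (i + 1) => Dacc S E i ∪ Dstep S E (Dacc S E i)

/-- `N` is the number of levels of `S \ E`: the least `N` with
`S \ E = D^(1) ∪ ⋯ ∪ D^(N)`. -/
def IsLevelsNumber {d : ℕ} (S E : Set (Fin d → ℕ)) (N : ℕ) : Prop :=
  (S \ E) ⊆ Dacc S E N ∧ ∀ M : ℕ, (S \ E) ⊆ Dacc S E M → N ≤ M

/-- The level `A_i := D^(N+1-i)` for `1 ≤ i ≤ N` (and `∅` otherwise). -/
def Alevel {d : ℕ} (S E : Set (Fin d → ℕ)) (N i : ℕ) : Set (Fin d → ℕ) :=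
  if 1 ≤ i ∧ i ≤ N then Dstep S E (Dacc S E (N - i)) else ∅

/-- `α` is (the representative of) a `U`-subspace of `E` (w.r.t. conductor `cE`):
`α ∈ E` and `α_j = cE_j` for every `j ∉ U`. -/
def IsSubspaceRep {d : ℕ} (E : Set (Fin d → ℕ)) (cE : Fin d → ℕ)
    (U : Finset (Fin d)) (α : Fin d → ℕ) : Prop :=
  α ∈ E ∧ ∀ j ∉ U, α j = cE j

/-- `β(U) ∈ Δ^E_F(α(U))`, at the level of representatives. -/
def SubDelta {d : ℕ} (E : Set (Fin d → ℕ)) (cE : Fin d → ℕ)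
    (U F : Finset (Fin d)) (α β : Fin d → ℕ) : Prop :=
  IsSubspaceRep E cE U β ∧ (∀ j ∈ F, β j = α j) ∧
  ∀ j ∈ U, j ∉ F → α j < β j

/-- `β(U) ∈ Δ̃^E_F(α(U))`, at the level of representatives. -/
def SubDeltaT {d : ℕ} (E : Set (Fin d → ℕ)) (cE : Fin d → ℕ)
    (U F : Finset (Fin d)) (α β : Fin d → ℕ) : Prop :=
  IsSubspaceRep E cE U β ∧ (∀ j ∈ F, β j = α j) ∧
  (∀ j ∈ U, j ∉ F → α j ≤ β j) ∧ ¬(∀ j ∈ U, β j = α j)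

/-- `α(U) ≤ θ(U)` are consecutive among the `U`-subspaces of `S`. -/
def SubConsecutive {d : ℕ} (S : Set (Fin d → ℕ)) (cE : Fin d → ℕ)
    (U : Finset (Fin d)) (α β : Fin d → ℕ) : Prop :=
  IsSubspaceRep S cE U α ∧ IsSubspaceRep S cE U β ∧ (∀ i ∈ U, α i ≤ β i) ∧
  ∀ δ : Fin d → ℕ, IsSubspaceRep S cE U δ → (∀ i ∈ U, α i ≤ δ i) →
    (∀ i ∈ U, δ i ≤ β i) → (∀ i ∈ U, δ i = α i) ∨ (∀ i ∈ U, δ i = β i)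

/-- `α(U)` is the complete infimum of the family of `U`-subspaces `β`. -/
def SubIsCompleteInf {d : ℕ} (S : Set (Fin d → ℕ)) (cE : Fin d → ℕ)
    (U : Finset (Fin d)) (α : Fin d → ℕ) {r : ℕ}
    (β : Fin r → Fin d → ℕ) : Prop :=
  2 ≤ r ∧ ∃ F : Fin r → Finset (Fin d),
    (∀ j, (F j).Nonempty ∧ F j ⊂ U) ∧
    (∀ j, SubDelta S cE U (F j) α (β j)) ∧
    (∀ j k, j ≠ k → ∀ i ∈ U, α i = min (β j i) (β k i)) ∧
    (∀ x : Fin d, ∃ j, x ∉ F j)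

/-! ### Helper lemmas -/

/-- Property (G2) for a set. -/
def HG2 {d : ℕ} (S : Set (Fin d → ℕ)) : Prop :=
  ∀ α ∈ S, ∀ β ∈ S, α ≠ β → ∀ i : Fin d, α i = β i →
    ∃ ε ∈ S, α i < ε i ∧ ∀ j : Fin d, j ≠ i →
      min (α j) (β j) ≤ ε j ∧ (α j ≠ β j → ε j = min (α j) (β j))

/-- A more convenient form of (G2). -/
theorem HG2.use {d : ℕ} {S : Set (Fin d → ℕ)} (h : HG2 S) {α β : Fin d → ℕ}
    (hα : α ∈ S) (hβ : β ∈ S) (hne : α ≠ β) {i : Fin d} (hi : α i = β i) :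
    ∃ ε ∈ S, α i < ε i ∧ (∀ j, min (α j) (β j) ≤ ε j) ∧
      ∀ j, α j ≠ β j → ε j = min (α j) (β j) := by
  obtain ⟨ε, hε, h1, h2⟩ := h α hα β hβ hne i hi
  refine ⟨ε, hε, h1, fun j => ?_, fun j hj => ?_⟩
  · by_cases hji : j = i
    · subst hji; exact (min_le_left _ _).trans h1.le
    · exact (h2 j hji).1
  · have hji : j ≠ i := by rintro rfl; exact hj hi
    exact (h2 j hji).2 hj

/-- (G2) for comparable elements. -/
theorem HG2.use_le {d : ℕ} {S : Set (Fin d → ℕ)} (h : HG2 S) {α β : Fin d → ℕ}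
    (hα : α ∈ S) (hβ : β ∈ S) (hle : α ≤ β) (hne : α ≠ β) {i : Fin d} (hi : α i = β i) :
    ∃ ε ∈ S, α i < ε i ∧ α ≤ ε ∧ ∀ j, α j < β j → ε j = α j := by
  obtain ⟨ε, hε, h1, h2, h3⟩ := h.use hα hβ hne hi
  refine ⟨ε, hε, h1, fun j => ?_, fun j hj => ?_⟩
  · have := h2 j; have h5 : α j ≤ β j := hle j; show α j ≤ ε j; omega
  · have := h3 j hj.ne; omega

/-- `a` realizes the minimal support containing `i` over `θ`. -/
def IsAtomAt {d : ℕ} (S : Set (Fin d → ℕ)) (θ : Fin d → ℕ) (i : Fin d) (a : Fin d → ℕ) : Prop :=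
  a ∈ S ∧ θ ≤ a ∧ θ i < a i ∧
    ∀ x ∈ S, θ ≤ x → θ i < x i → ∀ j, θ j < a j → θ j < x j

theorem IsGoodSemigroup.inf {d : ℕ} {S : Set (Fin d → ℕ)} (hS : IsGoodSemigroup S)
    {x y : Fin d → ℕ} (hx : x ∈ S) (hy : y ∈ S) : x ⊓ y ∈ S := hS.2.2.1 x hx y hy

theorem IsGoodSemigroup.hg2 {d : ℕ} {S : Set (Fin d → ℕ)} (hS : IsGoodSemigroup S) :
    HG2 S := hS.2.2.2.1

theorem IsGoodIdeal.inf {d : ℕ} {S E : Set (Fin d → ℕ)} (hE : IsGoodIdeal S E)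
    {x y : Fin d → ℕ} (hx : x ∈ E) (hy : y ∈ E) : x ⊓ y ∈ E := hE.2.2.2.1 x hx y hy

theorem IsGoodIdeal.hg2 {d : ℕ} {S E : Set (Fin d → ℕ)} (hE : IsGoodIdeal S E) :
    HG2 E := hE.2.2.2.2

theorem exists_atom {d : ℕ} {S : Set (Fin d → ℕ)} (hS : IsGoodSemigroup S)
    (θ : Fin d → ℕ) (i : Fin d) : ∃ a, IsAtomAt S θ i a := by
  classical
  obtain ⟨c, hc⟩ := hS.2.2.2.2
  let P : Set (Fin d → ℕ) := {a | a ∈ S ∧ θ ≤ a ∧ θ i < a i}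
  have hP : P.Nonempty := by
    refine ⟨fun j => c j + θ j + 1, hc _ (fun j => ?_), fun j => ?_, ?_⟩
    · show c j ≤ c j + θ j + 1
      omega
    · show θ j ≤ c j + θ j + 1
      omega
    · show θ i < c i + θ i + 1
      omega
  let μ : (Fin d → ℕ) → ℕ := fun a => (Finset.univ.filter (fun j => θ j < a j)).card
  obtain ⟨a, ha, hmin⟩ : ∃ a ∈ P, ∀ x ∈ P, μ a ≤ μ x := by
    obtain ⟨a, ha, h⟩ := (measure μ).wf.has_min P hP
    exact ⟨a, ha, fun x hx => not_lt.1 (h x hx)⟩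
  refine ⟨a, ha.1, ha.2.1, ha.2.2, fun x hx hxθ hxi j hj => ?_⟩
  by_contra hcon
  have h1 : a ⊓ x ∈ P := ⟨hS.inf ha.1 hx, le_inf ha.2.1 hxθ, lt_min ha.2.2 hxi⟩
  have h2 := hmin _ h1
  have h3 : μ (a ⊓ x) < μ a := by
    apply Finset.card_lt_card
    rw [Finset.ssubset_iff_of_subset]
    · refine ⟨j, by simpa using hj, ?_⟩
      simp only [Finset.mem_filter, Finset.mem_univ, true_and, Pi.inf_apply, not_lt]
      exact (min_le_right _ _).trans (not_lt.1 hcon)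
    · intro k
      simp only [Finset.mem_filter, Finset.mem_univ, true_and, Pi.inf_apply]
      intro hk
      exact hk.trans_le (min_le_left _ _)
  omega

theorem IsAtomAt.inf {d : ℕ} {S : Set (Fin d → ℕ)} (hS : IsGoodSemigroup S)
    {θ a x : Fin d → ℕ} {i : Fin d} (ha : IsAtomAt S θ i a) (hx : x ∈ S) (hle : θ ≤ x)
    (hi : θ i < x i) : IsAtomAt S θ i (a ⊓ x) := by
  refine ⟨hS.inf ha.1 hx, le_inf ha.2.1 hle, lt_min ha.2.2.1 hi, fun z hz hzθ hzi j hj => ?_⟩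
  exact ha.2.2.2 z hz hzθ hzi j (hj.trans_le (min_le_left _ _))

theorem IsAtomAt.disj {d : ℕ} {S : Set (Fin d → ℕ)} (hS : IsGoodSemigroup S)
    {θ a δ : Fin d → ℕ} {i j : Fin d} (hθ : θ ∈ S) (ha : IsAtomAt S θ i a) (hδ : δ ∈ S)
    (hle : θ ≤ δ) (hi : ¬ θ i < δ i) (hj : θ j < δ j) : a j = θ j := by
  have hne : θ ≠ δ := by rintro rfl; exact lt_irrefl _ hj
  have hi' : θ i = δ i := le_antisymm (hle i) (not_lt.1 hi)
  obtain ⟨x, hx, h1, h2, h3⟩ := hS.hg2.use_le hθ hδ hle hne hi'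
  by_contra hcon
  have h4 : θ j < a j := lt_of_le_of_ne (ha.2.1 j) (Ne.symm hcon)
  have h5 := ha.2.2.2 x hx h2 h1 j h4
  have := h3 j hj
  omega

theorem IsAtomAt.supp_eq {d : ℕ} {S : Set (Fin d → ℕ)} (hS : IsGoodSemigroup S)
    {θ a b : Fin d → ℕ} {i j : Fin d} (hθ : θ ∈ S) (ha : IsAtomAt S θ i a)
    (hb : IsAtomAt S θ j b) (hj : θ j < a j) (k : Fin d) : θ k < a k ↔ θ k < b k := by
  have hi : θ i < b i := by
    by_contra hcon
    have := ha.disj hS hθ hb.1 hb.2.1 hcon hb.2.2.1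
    omega
  exact ⟨fun h => ha.2.2.2 b hb.1 hb.2.1 hi k h, fun h => hb.2.2.2 a ha.1 ha.2.1 hj k h⟩

/-- Criterion for membership in `C`. -/
theorem cstep_crit {d : ℕ} {S E prev : Set (Fin d → ℕ)} (hd : 1 ≤ d)
    {θ : Fin d → ℕ} (hθ : θ ∈ Bstep S E prev) (y : Fin d → Fin d → ℕ)
    (hy : ∀ i, y i ∈ Bstep S E prev) (hle : ∀ i, θ ≤ y i) (hlt : ∀ i, θ i < y i i)
    (hsupp : ∀ i j, θ j < y i j → ∀ k, θ k < y i k ↔ θ k < y j k) :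
    θ ∈ Cstep S E prev := by
  classical
  let s : Fin d → Finset (Fin d) := fun i => Finset.univ.filter (fun k => θ k < y i k)
  have hs : ∀ i k, k ∈ s i ↔ θ k < y i k := fun i k => by simp [s]
  have hseq : ∀ i j, j ∈ s i → s i = s j := by
    intro i j hj
    ext k
    rw [hs, hs]
    exact hsupp i j ((hs i j).1 hj) k
  have hex : ∀ i, ∃ j, j ∉ s i := by
    intro i
    by_contra hcon
    push Not at hcon
    have := hθ.2 (y i) (hy i).1 (Or.inr fun j => (hs i j).1 (hcon j))
    have h2 := hlt i
    rw [this] at h2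
    exact lt_irrefl _ h2
  let T : Finset (Finset (Fin d)) := Finset.univ.image s
  let r := T.card
  let eq : Fin r ≃ T := T.equivFin.symm
  have hrep : ∀ t : Fin r, ∃ i, s i = (eq t : Finset (Fin d)) := by
    intro t
    have := (eq t).2
    obtain ⟨i, -, hi⟩ := Finset.mem_image.1 this
    exact ⟨i, hi⟩
  choose rep hrep using hrep
  have hr2 : 1 < r := by
    obtain ⟨j, hj⟩ := hex ⟨0, hd⟩
    refine Finset.one_lt_card.2 ⟨s ⟨0, hd⟩, Finset.mem_image_of_mem _ (Finset.mem_univ _),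
      s j, Finset.mem_image_of_mem _ (Finset.mem_univ _), ?_⟩
    intro h
    rw [h] at hj
    exact hj ((hs j j).2 (hlt j))
  have hrd : r ≤ d := by
    have := Finset.card_image_le (s := (Finset.univ : Finset (Fin d))) (f := s)
    simpa using this
  refine ⟨hθ, r, hr2, hrd, fun t => y (rep t), fun t => hy _, hθ.1.1, fun t => (hy _).1.1, hr2,
    fun t => (s (rep t))ᶜ, fun t => ⟨?_, ?_⟩, fun t => ⟨(hy _).1.1.1, ?_, ?_⟩, ?_, ?_⟩
  · obtain ⟨j, hj⟩ := hex (rep t)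
    exact ⟨j, Finset.mem_compl.2 hj⟩
  · intro h
    have h1 : rep t ∈ (s (rep t))ᶜ := by
      have h' : (s (rep t))ᶜ = Finset.univ := h
      rw [h']; exact Finset.mem_univ _
    exact Finset.mem_compl.1 h1 ((hs _ _).2 (hlt _))
  · intro k hk
    rw [Finset.mem_compl, hs] at hk
    exact le_antisymm (not_lt.1 hk) (hle _ k)
  · intro k hk
    rw [Finset.mem_compl, not_not, hs] at hk
    exact hk
  · intro t u htu
    funext k
    show θ k = min (y (rep t) k) (y (rep u) k)
    have h1 : θ k ≤ y (rep t) k := hle (rep t) k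
    have h2 : θ k ≤ y (rep u) k := hle (rep u) k
    by_contra hcon
    have h3 : θ k < y (rep t) k := by omega
    have h4 : θ k < y (rep u) k := by omega
    have h5 := hseq _ _ ((hs _ _).2 h3)
    have h6 := hseq _ _ ((hs _ _).2 h4)
    apply htu
    apply eq.injective
    apply Subtype.ext
    rw [← hrep, ← hrep, h5, h6]
  · intro x
    refine ⟨eq.symm ⟨s x, Finset.mem_image_of_mem _ (Finset.mem_univ _)⟩, ?_⟩
    simp only [Finset.mem_compl, not_not, hrep, Equiv.apply_symm_apply]
    exact (hs x x).2 (hlt x)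

theorem cstep_crit' {d : ℕ} {S E prev : Set (Fin d → ℕ)} (hd : 1 ≤ d) (hS : IsGoodSemigroup S)
    {θ δ : Fin d → ℕ} (hθ : θ ∈ Bstep S E prev) (hδ : δ ∈ Bstep S E prev) (hle : θ ≤ δ)
    (hat : ∀ i, ¬ θ i < δ i → ∃ b ∈ Bstep S E prev, IsAtomAt S θ i b) :
    θ ∈ Cstep S E prev := by
  classical
  choose b hb1 hb2 using hat
  have hθS : θ ∈ S := hθ.1.1.1
  have hδS : δ ∈ S := hδ.1.1.1
  refine cstep_crit hd hθ (fun i => if h : θ i < δ i then δ else b i h) ?_ ?_ ?_ ?_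
  · intro i
    split_ifs with h
    · exact hδ
    · exact hb1 i h
  · intro i
    split_ifs with h
    · exact hle
    · exact (hb2 i h).2.1
  · intro i
    split_ifs with h
    · exact h
    · exact (hb2 i h).2.2.1
  · intro i j hij k
    by_cases h : θ i < δ i
    · rw [dif_pos h] at hij ⊢
      rw [dif_pos hij]
    · rw [dif_neg h] at hij ⊢
      have h' : ¬ θ j < δ j := by
        intro hj
        have := (hb2 i h).disj hS hθS hδS hle h hj
        omega
      rw [dif_neg h']
      exact (hb2 i h).supp_eq hS hθS (hb2 j h') hij k

/-- The elements of `S \ E` not among the first `m` layers. -/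
def XX {d : ℕ} (S E : Set (Fin d → ℕ)) (m : ℕ) : Set (Fin d → ℕ) := (S \ E) \ Dacc S E m

theorem XX_succ {d : ℕ} {S E : Set (Fin d → ℕ)} {m : ℕ} {x : Fin d → ℕ} :
    x ∈ XX S E (m + 1) ↔ x ∈ XX S E m ∧ x ∉ Dstep S E (Dacc S E m) := by
  simp only [XX, Dacc, Set.mem_sdiff, Set.mem_union]
  tauto

theorem bstep_up {d : ℕ} {S E : Set (Fin d → ℕ)} {m : ℕ} {x y : Fin d → ℕ}
    (hx : x ∈ Bstep S E (Dacc S E m)) (hy : y ∈ XX S E m) (hxy : x ≤ y) :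
    y ∈ Bstep S E (Dacc S E m) := by
  refine ⟨hy, fun z hz hyz => ?_⟩
  rcases hyz with h | h
  · exact h.symm
  · have hxz : ∀ j, x j < z j := fun j => (hxy j).trans_lt (h j)
    have := hx.2 z hz (Or.inr hxz)
    funext j
    have h1 := hxz j
    rw [this] at h1
    exact absurd h1 (lt_irrefl _)

theorem XX_up {d : ℕ} {S E : Set (Fin d → ℕ)} {m : ℕ} {x : Fin d → ℕ}
    (hx : x ∈ XX S E (m + 1)) (j : Fin d) :
    ∃ y ∈ XX S E m, x ≤ y ∧ x j < y j := by
  obtain ⟨h1, h2⟩ := XX_succ.1 hx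
  by_cases hB : x ∈ Bstep S E (Dacc S E m)
  · have hC : x ∈ Cstep S E (Dacc S E m) := by
      by_contra hC
      exact h2 ⟨hB, hC⟩
    obtain ⟨-, r, -, -, β, hβ, -, -, -, F, -, hF, -, hcov⟩ := hC
    obtain ⟨t, ht⟩ := hcov j
    refine ⟨β t, (hβ t).1, fun k => ?_, (hF t).2.2 j ht⟩
    by_cases hk : k ∈ F t
    · exact ((hF t).2.1 k hk).ge
    · exact ((hF t).2.2 k hk).le
  · have : ∃ y ∈ XX S E m, DomLE x y ∧ y ≠ x := by
      by_contra hcon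
      push Not at hcon
      exact hB ⟨h1, hcon⟩
    obtain ⟨y, hy, hxy, hne⟩ := this
    rcases hxy with h | h
    · exact absurd h.symm hne
    · exact ⟨y, hy, fun k => (h k).le, h j⟩

/-- The sets `XX` are downward closed in `S \ E`. -/
theorem XX_mono {d : ℕ} (hd : 1 ≤ d) {S E : Set (Fin d → ℕ)} (hS : IsGoodSemigroup S)
    (hE : IsGoodIdeal S E) (m : ℕ) : ∀ α β : Fin d → ℕ, α ∈ S → α ∉ E → β ∈ XX S E m → α ≤ β →
      α ∈ XX S E m := by
  classical
  induction m with
  | zero =>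
    intro α β hα hα' _ _
    exact ⟨⟨hα, hα'⟩, by simp [Dacc]⟩
  | succ m ih =>
    intro α β hα hα' hβ hle
    obtain ⟨hβ1, hβ2⟩ := XX_succ.1 hβ
    have hαX := ih α β hα hα' hβ1 hle
    refine XX_succ.2 ⟨hαX, fun hαD => ?_⟩
    have hαB := hαD.1
    by_cases hne : α = β
    · exact hβ2 (hne ▸ hαD)
    have hβB := bstep_up hαB hβ1 hle
    have hβC : β ∈ Cstep S E (Dacc S E m) := by
      by_contra hC
      exact hβ2 ⟨hβB, hC⟩
    obtain ⟨-, r, hr, -, b, hb, -, -, -, F, -, hF, -, hcov⟩ := hβC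
    have hβb : ∀ t, β ≤ b t := by
      intro t k
      by_cases hk : k ∈ F t
      · exact ((hF t).2.1 k hk).ge
      · exact ((hF t).2.2 k hk).le
    choose t ht using hcov
    have hαb : ∀ u, α ≤ b u := fun u => hle.trans (hβb u)
    have htt : ∀ i, α i < b (t i) i := fun i => (hle i).trans_lt ((hF (t i)).2.2 i (ht i))
    have hbS : ∀ u, b u ∈ S := fun u => (hb u).1.1.1
    choose a ha using exists_atom hS α
    have hc : ∀ i, IsAtomAt S α i (a i ⊓ b (t i)) := fun i =>
      (ha i).inf hS (hbS _) (hαb _) (htt i)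
    -- a good choice of the index
    have hkey : ∃ u : Fin r, ∀ i, ¬ α i < b u i → a i ⊓ b (t i) ∉ E := by
      by_cases h : ∃ i0, a i0 ⊓ b (t i0) ∈ E
      · obtain ⟨i0, hi0⟩ := h
        refine ⟨t i0, fun i hi hiE => hα' ?_⟩
        have hmeet : (a i0 ⊓ b (t i0)) ⊓ (a i ⊓ b (t i)) = α := by
          funext k
          show min ((a i0 ⊓ b (t i0)) k) ((a i ⊓ b (t i)) k) = α k
          have h1 : α k ≤ (a i0 ⊓ b (t i0)) k := (hc i0).2.1 k
          have h2 : α k ≤ (a i ⊓ b (t i)) k := (hc i).2.1 k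
          by_contra hcon
          have h3 : α k < (a i0 ⊓ b (t i0)) k := by omega
          have h4 : α k < (a i ⊓ b (t i)) k := by omega
          have h5 := (hc i0).supp_eq hS hα (ha k) h3 i
          have h6 := (hc i).supp_eq hS hα (ha k) h4 i
          have h7 : α i < (a i0 ⊓ b (t i0)) i := h5.2 (h6.1 (hc i).2.2.1)
          exact hi (h7.trans_le (min_le_right _ _))
        rw [← hmeet]
        exact hE.inf hi0 hiE
      · push Not at h
        exact ⟨⟨0, by omega⟩, fun i _ => h i⟩
    obtain ⟨u, hu⟩ := hkey
    refine hαD.2 (cstep_crit' hd hS hαB (hb u) (hαb u) fun i hi => ?_)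
    refine ⟨a i ⊓ b (t i), bstep_up hαB ?_ (hc i).2.1, hc i⟩
    exact ih _ (b (t i)) (hc i).1 (hu i hi) (hb _).1 inf_le_right

/-- The main lifting lemma. -/
theorem XX_lift {d : ℕ} (hd : 1 ≤ d) {S E : Set (Fin d → ℕ)} (hS : IsGoodSemigroup S)
    (hE : IsGoodIdeal S E) (m : ℕ) : ∀ (θ δ : Fin d → ℕ) (p : Fin d), θ ∈ S →
      (∀ f ∈ E, θ ≤ f → θ p < f p) → δ ∈ XX S E m → θ ≤ δ → θ p < δ p → θ ∈ XX S E (m + 1) := by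
  classical
  induction m with
  | zero =>
    intro θ δ p hθ hp hδ hle hlt
    have hθE : θ ∉ E := fun h => lt_irrefl _ (hp θ h le_rfl)
    have hθX := XX_mono hd hS hE 0 θ δ hθ hθE hδ hle
    refine XX_succ.2 ⟨hθX, fun hD => ?_⟩
    refine hD.2 (cstep_crit' hd hS hD.1 (bstep_up hD.1 hδ hle) hle fun i hi => ?_)
    obtain ⟨a, ha⟩ := exists_atom hS θ i
    refine ⟨a, bstep_up hD.1 ⟨⟨ha.1, fun haE => ?_⟩, by simp [Dacc]⟩ ha.2.1, ha⟩
    have h1 := hp a haE ha.2.1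
    have h2 := ha.disj hS hθ hδ.1.1 hle hi hlt
    omega
  | succ m ih =>
    intro θ δ p hθ hp hδ hle hlt
    have hθE : θ ∉ E := fun h => lt_irrefl _ (hp θ h le_rfl)
    have hθX := XX_mono hd hS hE (m + 1) θ δ hθ hθE hδ hle
    refine XX_succ.2 ⟨hθX, fun hD => ?_⟩
    refine hD.2 (cstep_crit' hd hS hD.1 (bstep_up hD.1 hδ hle) hle fun i hi => ?_)
    obtain ⟨a, ha⟩ := exists_atom hS θ i
    obtain ⟨η, hη, hδη, hi'⟩ := XX_up hδ i
    have hb : IsAtomAt S θ i (a ⊓ η) :=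
      ha.inf hS hη.1.1 (hle.trans hδη) ((hle i).trans_lt hi')
    have hbp : (a ⊓ η) p = θ p := hb.disj hS hθ hδ.1.1 hle hi hlt
    refine ⟨a ⊓ η, bstep_up hD.1 ?_ hb.2.1, hb⟩
    refine ih (a ⊓ η) η p hb.1 (fun f hf hbf => ?_) hη inf_le_right ?_
    · rw [hbp]
      exact hp f hf (hb.2.1.trans hbf)
    · rw [hbp]
      exact hlt.trans_le (hδη p)

theorem exists_q {d : ℕ} (hd : 1 ≤ d) {S E : Set (Fin d → ℕ)}
    (hE : IsGoodIdeal S E) {α : Fin d → ℕ} (hα : α ∉ E) :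
    ∃ q, ∀ f ∈ E, α ≤ f → α q < f q := by
  classical
  by_contra hcon
  push Not at hcon
  choose f hf hle hq using hcon
  apply hα
  have hne : (Finset.univ : Finset (Fin d)).Nonempty := ⟨⟨0, hd⟩, Finset.mem_univ _⟩
  have h1 : Finset.univ.inf' hne f ∈ E :=
    Finset.inf'_mem E (fun x hx y hy => hE.inf hx hy) _ _ _ fun i _ => hf i
  have h2 : Finset.univ.inf' hne f = α := by
    apply le_antisymm
    · intro k
      exact ((Finset.inf'_le f (Finset.mem_univ k)) k).trans (hq k)
    · exact Finset.le_inf' _ _ fun i _ => hle i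
  rwa [h2] at h1

/-- The case in which no element of `E` above `δ` agrees with `δ` at `i`. -/
theorem XX_side {d : ℕ} {S E : Set (Fin d → ℕ)} (hS : IsGoodSemigroup S)
    (hE : IsGoodIdeal S E) {α δ e0 : Fin d → ℕ} {i : Fin d} (he0 : e0 ∈ E) (he0α : α ≤ e0)
    (he0i : e0 i = α i) (hδ : δ ∈ S) (hαδ : α ≤ δ) (hδi : δ i = α i)
    (hno : ∀ f ∈ E, δ ≤ f → f i ≠ δ i) :
    ∃ e ∈ E, ∃ ε ∈ S, ∃ p, α ≤ e ∧ e ⊓ δ ≤ ε ∧ α i < ε i ∧ ε p = e p ∧ e p < δ p ∧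
      ∀ f ∈ E, e ⊓ δ ≤ f → α i < f i → e p < f p := by
  classical
  let P : Set (Fin d → ℕ) := {e | e ∈ E ∧ α ≤ e ∧ e i = α i}
  let μ : (Fin d → ℕ) → ℕ := fun e => ∑ j, (δ j - e j)
  obtain ⟨e, ⟨heE, hαe, hei⟩, hmin⟩ : ∃ e ∈ P, ∀ x ∈ P, μ e ≤ μ x := by
    obtain ⟨a, ha, h⟩ := (measure μ).wf.has_min P ⟨e0, he0, he0α, he0i⟩
    exact ⟨a, ha, fun x hx => not_lt.1 (h x hx)⟩
  have hp : ∃ p, e p < δ p := by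
    by_contra hcon
    push Not at hcon
    exact hno e heE hcon (hei.trans hδi.symm)
  obtain ⟨p, hp⟩ := hp
  have hne : e ≠ δ := by rintro rfl; exact lt_irrefl _ hp
  obtain ⟨ε, hε, h1, h2, h3⟩ := hS.hg2.use (hE.1 heE) hδ hne (hei.trans hδi.symm)
  refine ⟨e, heE, ε, hε, p, hαe, h2, by omega, ?_, hp, ?_⟩
  · have := h3 p hp.ne
    omega
  intro f hf hef hfi
  by_contra hcon
  have hef' : ∀ j, min (e j) (δ j) ≤ f j := hef
  have hfp : f p = e p := by have := hef' p; omega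
  have hαf : ∀ j, α j ≤ f j := fun j => by
    
    have h5 := hef' j; have h6 : α j ≤ e j := hαe j; have h7 : α j ≤ δ j := hαδ j; omega
  have hne' : f ⊓ e ≠ f := by
    intro h
    have := congrFun h i
    simp only [Pi.inf_apply] at this
    omega
  obtain ⟨g, hg, g1, g2, g3⟩ := hE.hg2.use_le (hE.inf hf heE) hf inf_le_left hne' (i := p)
    (by simp only [Pi.inf_apply]; omega)
  have hgle : ∀ j, min (f j) (e j) ≤ g j := g2
  have hgp : e p < g p := by simp only [Pi.inf_apply] at g1; omega
  have hgi : g i = α i := by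
    have := g3 i (by simp only [Pi.inf_apply]; omega)
    simp only [Pi.inf_apply] at this
    omega
  have hgP : g ∈ P := ⟨hg, fun j => by
    
    have h5 := hgle j; have h6 := hαf j; have h7 : α j ≤ e j := hαe j; show α j ≤ g j; omega, hgi⟩
  have h5 := hmin g hgP
  have h6 : μ g < μ e := by
    apply Finset.sum_lt_sum
    · intro j _
      have := hgle j; have := hef' j
      omega
    · exact ⟨p, Finset.mem_univ _, by omega⟩
  omega

theorem XX_ext {d : ℕ} (hd : 1 ≤ d) {S E : Set (Fin d → ℕ)} (hS : IsGoodSemigroup S)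
    (hE : IsGoodIdeal S E) (m : ℕ) : ∀ (α δ e : Fin d → ℕ) (i q : Fin d),
      e ∈ E → α ≤ e → e i = α i → (∀ f ∈ E, α ≤ f → α q < f q) → δ ∈ XX S E m → α ≤ δ →
      α q < δ q → ∃ ω ∈ XX S E m, α ≤ ω ∧ α i < ω i ∧ α q < ω q := by
  induction m with
  | zero =>
    intro α δ e i q he hαe hei hq hδ hαδ hδq
    by_cases hδi : α i < δ i
    · exact ⟨δ, hδ, hαδ, hδi, hδq⟩
    have hδi' : δ i = α i := le_antisymm (not_lt.1 hδi) (hαδ i)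
    by_cases hno : ∀ f ∈ E, δ ≤ f → f i ≠ δ i
    · obtain ⟨e', he', ε, hε, p, hαe', h1, h2, h3, h4, h5⟩ :=
        XX_side hS hE he hαe hei hδ.1.1 hαδ hδi' hno
      refine ⟨ε, ⟨⟨hε, fun hεE => ?_⟩, by simp [Dacc]⟩, (le_inf hαe' hαδ).trans h1, h2,
        (lt_min (hq e' he' hαe') hδq).trans_le (h1 q)⟩
      have := h5 ε hεE h1 h2
      omega
    · push Not at hno
      obtain ⟨β, hβ, hδβ, hβi⟩ := hno
      have hne : δ ≠ β := by rintro rfl; exact hδ.1.2 hβ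
      obtain ⟨a, ha, a1, a2, a3⟩ := hS.hg2.use_le hδ.1.1 (hE.1 hβ) hδβ hne hβi.symm
      obtain ⟨q', hq'⟩ := exists_q hd hE hδ.1.2
      refine ⟨a, ⟨⟨ha, fun haE => ?_⟩, by simp [Dacc]⟩, hαδ.trans a2, by omega,
        hδq.trans_le (a2 q)⟩
      have h1 := hq' a haE a2
      have h2 := a3 q' (hq' β hβ hδβ)
      omega
  | succ m ih =>
    intro α δ e i q he hαe hei hq hδ hαδ hδq
    by_cases hδi : α i < δ i
    · exact ⟨δ, hδ, hαδ, hδi, hδq⟩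
    have hδi' : δ i = α i := le_antisymm (not_lt.1 hδi) (hαδ i)
    by_cases hno : ∀ f ∈ E, δ ≤ f → f i ≠ δ i
    · obtain ⟨e', he', ε, hε, p, hαe', h1, h2, h3, h4, h5⟩ :=
        XX_side hS hE he hαe hei hδ.1.1 hαδ hδi' hno
      obtain ⟨η, hη, hδη, hηi⟩ := XX_up hδ i
      have hηi' : α i < η i := by omega
      have hle : e' ⊓ δ ≤ ε ⊓ η := le_inf h1 (inf_le_right.trans hδη)
      have hi : α i < (ε ⊓ η) i := lt_min h2 hηi'
      have hp : (ε ⊓ η) p = e' p := by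
        have h6 : δ p ≤ η p := hδη p
        simp only [Pi.inf_apply]
        omega
      refine ⟨ε ⊓ η, ?_, (le_inf hαe' hαδ).trans hle, hi,
        (lt_min (hq e' he' hαe') hδq).trans_le (hle q)⟩
      refine XX_lift hd hS hE m _ η p (hS.inf hε hη.1.1) (fun f hf hεf => ?_) hη inf_le_right ?_
      · rw [hp]
        exact h5 f hf (hle.trans hεf) (hi.trans_le (hεf i))
      · rw [hp]
        exact h4.trans_le (hδη p)
    · push Not at hno
      obtain ⟨β, hβ, hδβ, hβi⟩ := hno
      have hne : δ ≠ β := by rintro rfl; exact hδ.1.2 hβ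
      obtain ⟨a, ha, a1, a2, a3⟩ := hS.hg2.use_le hδ.1.1 (hE.1 hβ) hδβ hne hβi.symm
      obtain ⟨q', hq'⟩ := exists_q hd hE hδ.1.2
      have haq := a3 q' (hq' β hβ hδβ)
      obtain ⟨δ', hδ', hle', hlt'⟩ := XX_up hδ q'
      obtain ⟨ω, hω, w1, w2, w3⟩ := ih δ δ' β i q' hβ hδβ hβi hq' hδ' hle' hlt'
      have hle : δ ≤ a ⊓ ω := le_inf a2 w1
      have hp : (a ⊓ ω) q' = δ q' := by
        simp only [Pi.inf_apply]
        omega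
      refine ⟨a ⊓ ω, ?_, hαδ.trans hle, ?_, hδq.trans_le (hle q)⟩
      · refine XX_lift hd hS hE m _ ω q' (hS.inf ha hω.1.1) (fun f hf haf => ?_) hω
          inf_le_right ?_
        · rw [hp]
          exact hq' f hf (hle.trans haf)
        · rw [hp]
          exact w3
      · have := lt_min a1 w2
        simp only [Pi.inf_apply]
        omega

theorem stmt_10 {d : ℕ} (hd : 1 ≤ d) (S E : Set (Fin d → ℕ))
    (hS : IsGoodSemigroup S) (hE : IsGoodIdeal S E) (hprop : E ≠ S)
    (N : ℕ) (hN : IsLevelsNumber S E N)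
    (i : ℕ) (α : Fin d → ℕ) (hα : α ∈ Alevel S E N i)
    (F : Finset (Fin d)) (hF : F ⊂ Finset.univ)
    (hEF : (DeltaSet E F α).Nonempty)
    (θ : Fin d → ℕ) (hθ : θ ∈ DeltaTilde S Fᶜ α)
    (hcons : ConsecutiveIn S α θ)
    (hcase :
      (∃ δ ∈ Alevel S E N (i + 1), ∀ j : Fin d, θ j < δ j) ∨
      (∃ δ ∈ Alevel S E N (i + 1), ∃ H : Finset (Fin d), H ⊆ F ∧
        δ ∈ DeltaSet S H θ) ∨
      (∃ δ, δ ∈ Alevel S E N i ∩ DeltaSet S F α) ∨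
      (∃ δ ∈ Alevel S E N (i + 1) ∩ DeltaSet S F α,
        ∃ β ∈ DeltaTilde E F α, δ ≤ β) ∨
      (∃ δ ∈ Alevel S E N (i + 1) ∩ DeltaSet S F α,
        DeltaTilde E F δ = ∅)) :
    θ ∈ Alevel S E N i := by
  classical
  unfold Alevel at hα
  split_ifs at hα with hi
  swap
  · exact absurd hα (Set.notMem_empty _)
  have hαX : α ∈ XX S E (N - i) := hα.1.1
  have hαX' : α ∉ XX S E (N - i + 1) := fun h => (XX_succ.1 h).2 hα
  obtain ⟨q, hq⟩ := exists_q hd hE hαX.1.2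
  obtain ⟨e, heE, heF, heF'⟩ := hEF
  have hαe : α ≤ e := fun k => by
    by_cases hk : k ∈ F
    · exact (heF k hk).ge
    · exact (heF' k hk).le
  have hqF : q ∉ F := fun h => by
    have h1 := hq e heE hαe
    have h2 := heF q h
    omega
  obtain ⟨hθS, hαθ, hcon⟩ := hcons.2
  obtain ⟨⟨-, hθ1, -⟩, hθne⟩ := hθ
  have hθq : θ q = α q := hθ1 q (Finset.mem_compl.2 hqF)
  have hqθ : ∀ f ∈ E, θ ≤ f → θ q < f q := fun f hf h => by
    rw [hθq]; exact hq f hf (hαθ.trans h)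
  have hθE : θ ∉ E := fun h => lt_irrefl _ (hqθ θ h le_rfl)
  -- elements of the next level
  have hnext : ∀ δ ∈ Alevel S E N (i + 1), ∃ n, N - i = n + 1 ∧ δ ∈ XX S E n := by
    intro δ hδ
    unfold Alevel at hδ
    split_ifs at hδ with h
    · exact ⟨N - (i + 1), by omega, hδ.1.1⟩
    · exact absurd hδ (Set.notMem_empty _)
  have hfin : ∀ δ n, N - i = n + 1 → δ ∈ XX S E n → α ≤ δ → α q < δ q →
      θ ∈ XX S E (N - i) := by
    intro δ n hn hδ hαδ hδq
    have hi0 : ∃ i0, α i0 < θ i0 := by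
      by_contra h
      push Not at h
      exact hθne (le_antisymm h hαθ)
    obtain ⟨i0, hi0⟩ := hi0
    have hi0F : i0 ∈ F := by
      by_contra h
      have := hθ1 i0 (Finset.mem_compl.2 h)
      omega
    obtain ⟨ω, hω, w1, w2, w3⟩ := XX_ext hd hS hE n α δ e i0 q heE hαe (heF i0 hi0F) hq hδ
      hαδ hδq
    have hθω : θ ≤ ω := by
      rcases hcon (ω ⊓ θ) (hS.inf hω.1.1 hθS) (le_inf w1 hαθ) inf_le_right with h | h
      · have h1 : min (ω i0) (θ i0) = α i0 := congrFun h i0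
        omega
      · exact inf_eq_right.1 h
    rw [hn]
    exact XX_lift hd hS hE n θ ω q hθS hqθ hω hθω (by omega)
  have hθX : θ ∈ XX S E (N - i) := by
    rcases hcase with ⟨δ, hδ, h⟩ | ⟨δ, hδ, H, hH, h⟩ | ⟨δ, hδ, h⟩ | ⟨δ, ⟨hδ, h⟩, -⟩ |
      ⟨δ, ⟨hδ, h⟩, -⟩
    · obtain ⟨n, hn, hδX⟩ := hnext δ hδ
      rw [hn]
      exact XX_lift hd hS hE n θ δ q hθS hqθ hδX (fun k => (h k).le) (h q)
    · obtain ⟨n, hn, hδX⟩ := hnext δ hδ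
      rw [hn]
      refine XX_lift hd hS hE n θ δ q hθS hqθ hδX (fun k => ?_) (h.2.2 q fun hc => hqF (hH hc))
      by_cases hk : k ∈ H
      · exact (h.2.1 k hk).ge
      · exact (h.2.2 k hk).le
    · exfalso
      apply hαX'
      unfold Alevel at hδ
      rw [if_pos hi] at hδ
      refine XX_lift hd hS hE _ α δ q hαX.1.1 hq hδ.1.1 (fun k => ?_) (h.2.2 q hqF)
      by_cases hk : k ∈ F
      · exact (h.2.1 k hk).ge
      · exact (h.2.2 k hk).le
    all_goals
      obtain ⟨n, hn, hδX⟩ := hnext δ hδ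
      refine hfin δ n hn hδX (fun k => ?_) (h.2.2 q hqF)
      by_cases hk : k ∈ F
      · exact (h.2.1 k hk).ge
      · exact (h.2.2 k hk).le
  unfold Alevel
  rw [if_pos hi]
  by_contra hnot
  exact hαX' (XX_mono hd hS hE _ α θ hαX.1.1 hαX.1.2 (XX_succ.2 ⟨hθX, hnot⟩) hαθ)
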